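/- arXiv:1002.0190 — 2 statements merged into one kernel-verified Lean document; each statement's English description precedes it below -/
import Mathlib

section
/- The multisets {1,1} and {1,2} are the only representable multisets of size 2: a 2-blocked point set with colour classes of sizes n₁ and n₂ exists if and only if {n₁,n₂} = {1,1} or {n₁,n₂} = {1,2}. -/
/-- `x` blocks `v` and `w` if `x` lies strictly between `v` and `w`. -/
def Blocks {E : Type*} [AddCommGroup E] [Module ℝ E] (x v w : E) : Prop :=
  x ∈ openSegment ℝ v w

/-- `v` and `w` are visible with respect to `P` if no point of `P` blocks them. -/
def Visible {E : Type*} [AddCommGroup E] [Module ℝ E] (P : Set E) (v w : E) : Prop :=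
  ∀ x ∈ P, ¬ Blocks x v w

/-- `c` is a blocked colouring of `P`: distinct points of `P` are visible
iff they get different colours. -/
def BlockedColouring {E : Type*} [AddCommGroup E] [Module ℝ E] {k : ℕ}
    (P : Set E) (c : E → Fin k) : Prop :=
  ∀ v ∈ P, ∀ w ∈ P, v ≠ w → (Visible P v w ↔ c v ≠ c w)

/-- `P` is `k`-blocked. -/
def KBlocked {E : Type*} [AddCommGroup E] [Module ℝ E] (k : ℕ) (P : Set E) : Prop :=
  P.Finite ∧ ∃ c : E → Fin k, BlockedColouring P c

/-- `P` is `{n₁,…,n_k}`-blocked where `N` is the multiset of colour class sizes. -/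
def IsNBlocked {E : Type*} [AddCommGroup E] [Module ℝ E] (N : Multiset ℕ) (P : Set E) : Prop :=
  P.Finite ∧ ∃ (k : ℕ) (c : E → Fin k), BlockedColouring P c ∧
    N = Finset.univ.val.map (fun i : Fin k => (P ∩ c ⁻¹' {i}).ncard)

/-- A multiset of positive integers is representable if some planar point set is
`N`-blocked. -/
def Representable (N : Multiset ℕ) : Prop :=
  ∃ P : Set (ℝ × ℝ), IsNBlocked N P

/-- A set is in convex position if no point lies in the convex hull of the others. -/
def ConvexPosition {E : Type*} [AddCommGroup E] [Module ℝ E] (K : Set E) : Prop :=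
  ∀ x ∈ K, x ∉ convexHull ℝ (K \ {x})

/-- `P` is `N`-midpoint-blocked: `N`-blocked, and midpoints of monochromatic pairs
belong to `P`. -/
def IsNMidpointBlocked {E : Type*} [AddCommGroup E] [Module ℝ E]
    (N : Multiset ℕ) (P : Set E) : Prop :=
  P.Finite ∧ ∃ (k : ℕ) (c : E → Fin k), BlockedColouring P c ∧
    (∀ v ∈ P, ∀ w ∈ P, v ≠ w → c v = c w → midpoint ℝ v w ∈ P) ∧
    N = Finset.univ.val.map (fun i : Fin k => (P ∩ c ⁻¹' {i}).ncard)

section BlockedColouring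

variable {E : Type*} [AddCommGroup E] [Module ℝ E] {k : ℕ} {P : Set E} {c : E → Fin k}

lemma blocks_iff_sbtw {x v w : E} (h : v ≠ w) : Blocks x v w ↔ Sbtw ℝ v x w := by
  rw [Blocks, openSegment_eq_image_lineMap, sbtw_iff_mem_image_Ioo_and_ne]
  simp [h]

lemma BlockedColouring.not_sbtw (hc : BlockedColouring P c) {v w x : E} (hv : v ∈ P) (hw : w ∈ P)
    (hx : x ∈ P) (hne : c v ≠ c w) : ¬ Sbtw ℝ v x w := by
  have hvw : v ≠ w := fun h => hne (h ▸ rfl)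
  exact fun h => (hc v hv w hw hvw).2 hne x hx ((blocks_iff_sbtw hvw).2 h)

lemma BlockedColouring.exists_sbtw (hc : BlockedColouring P c) (hP : P.Finite) {v w : E}
    (hv : v ∈ P) (hw : w ∈ P) (hvw : v ≠ w) (he : c v = c w) :
    ∃ b ∈ P, c b ≠ c v ∧ Sbtw ℝ v b w := by
  let S : Set ℝ := {t | t ∈ Set.Ioo (0 : ℝ) 1 ∧ AffineMap.lineMap v w t ∈ P}
  have hS : S.Finite :=
    (hP.preimage (AffineMap.lineMap_injective ℝ hvw).injOn).subset fun t ht => ht.2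
  have hne : S.Nonempty := by
    have h : ¬ Visible P v w := fun h => (hc v hv w hw hvw).1 h he
    simp only [Visible, not_forall, not_not] at h
    obtain ⟨x, hx, hb⟩ := h
    rw [Blocks, openSegment_eq_image_lineMap] at hb
    obtain ⟨t, ht, rfl⟩ := hb
    exact ⟨t, ht, hx⟩
  obtain ⟨t, ht, hmin⟩ := Set.exists_min_image S id hS hne
  have hs : Sbtw ℝ v (AffineMap.lineMap v w t) w :=
    sbtw_iff_mem_image_Ioo_and_ne.2 ⟨⟨t, ht.1, rfl⟩, hvw⟩
  refine ⟨_, ht.2, ?_, hs⟩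
  refine Ne.symm ((hc v hv _ ht.2 hs.left_ne).1 fun x hx hb => ?_)
  rw [Blocks, openSegment_eq_image_lineMap] at hb
  obtain ⟨s, hs, rfl⟩ := hb
  rw [AffineMap.lineMap_lineMap_right] at hx
  have := hmin (s * t) ⟨⟨mul_pos hs.1 ht.1.1, by nlinarith [hs.1, hs.2, ht.1.1, ht.1.2]⟩, hx⟩
  simp only [id] at this
  nlinarith [hs.2, ht.1.1]

lemma BlockedColouring.not_sbtw_of_eq (hc : BlockedColouring P c) (hP : P.Finite) {x y z : E}
    (hx : x ∈ P) (hy : y ∈ P) (hz : z ∈ P) (hxy : c x = c y) (hxz : c x = c z) :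
    ¬ Sbtw ℝ x y z := by
  intro h
  obtain ⟨b, hb, hcb, hs⟩ := hc.exists_sbtw hP hx hy h.left_ne hxy
  exact hc.not_sbtw hb hz hy (hxz ▸ hcb) (h.trans_left_right hs)

lemma BlockedColouring.not_collinear (hc : BlockedColouring P c) (hP : P.Finite) {x y z : E}
    (hx : x ∈ P) (hy : y ∈ P) (hz : z ∈ P) (hxy : c x = c y) (hxz : c x = c z)
    (h₁ : x ≠ y) (h₂ : x ≠ z) (h₃ : y ≠ z) : ¬ Collinear ℝ {x, y, z} := by
  intro h
  rcases h.wbtw_or_wbtw_or_wbtw with h | h | h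
  · exact hc.not_sbtw_of_eq hP hx hy hz hxy hxz ⟨h, h₁.symm, h₃⟩
  · exact hc.not_sbtw_of_eq hP hy hz hx (hxy.symm.trans hxz) hxy.symm ⟨h, h₃.symm, h₂.symm⟩
  · exact hc.not_sbtw_of_eq hP hz hx hy hxz.symm (hxz.symm.trans hxy) ⟨h, h₂, h₁⟩

end BlockedColouring

/-- Twice the signed area of the triangle `x y z`. -/
def doubleArea (x y z : ℝ × ℝ) : ℝ :=
  (y.1 - x.1) * (z.2 - x.2) - (y.2 - x.2) * (z.1 - x.1)

lemma collinear_of_doubleArea_eq_zero {x y z : ℝ × ℝ} (h : doubleArea x y z = 0) :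
    Collinear ℝ {x, y, z} := by
  by_cases hxy : x = y
  · subst hxy
    simpa using collinear_pair ℝ x z
  rw [collinear_iff_of_mem (p₀ := x) (by simp)]
  refine ⟨y - x, ?_⟩
  simp only [Set.mem_insert_iff, Set.mem_singleton_iff, forall_eq_or_imp, forall_eq, vadd_eq_add]
  refine ⟨⟨0, by simp⟩, ⟨1, by simp⟩, ?_⟩
  simp only [doubleArea] at h
  by_cases h₁ : y.1 - x.1 = 0
  · have h₂ : y.2 - x.2 ≠ 0 := fun h₂ =>
      hxy (Prod.ext (sub_eq_zero.1 h₁).symm (sub_eq_zero.1 h₂).symm)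
    refine ⟨(z.2 - x.2) / (y.2 - x.2), Prod.ext ?_ ?_⟩ <;>
      simp only [Prod.fst_add, Prod.snd_add, Prod.smul_fst, Prod.smul_snd, Prod.fst_sub,
        Prod.snd_sub, smul_eq_mul] <;> field_simp <;> linarith
  · refine ⟨(z.1 - x.1) / (y.1 - x.1), Prod.ext ?_ ?_⟩ <;>
      simp only [Prod.fst_add, Prod.snd_add, Prod.smul_fst, Prod.smul_snd, Prod.fst_sub,
        Prod.snd_sub, smul_eq_mul] <;> field_simp <;> linarith

lemma doubleArea_lineMap (x y z : ℝ × ℝ) (r s t : ℝ) :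
    doubleArea (AffineMap.lineMap x y r) (AffineMap.lineMap y z s) (AffineMap.lineMap z x t) =
      ((1 - r) * (1 - s) * (1 - t) + r * s * t) * doubleArea x y z := by
  simp only [doubleArea, AffineMap.lineMap_apply, vsub_eq_sub, vadd_eq_add, Prod.fst_add,
    Prod.snd_add, Prod.smul_fst, Prod.smul_snd, Prod.fst_sub, Prod.snd_sub, smul_eq_mul]
  ring

lemma abs_doubleArea_lt {x y z a b d : ℝ × ℝ} (h : doubleArea x y z ≠ 0) (ha : Sbtw ℝ x a y)
    (hb : Sbtw ℝ y b z) (hd : Sbtw ℝ z d x) :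
    doubleArea a b d ≠ 0 ∧ |doubleArea a b d| < |doubleArea x y z| := by
  obtain ⟨⟨r, ⟨hr₀, hr₁⟩, rfl⟩, -⟩ := sbtw_iff_mem_image_Ioo_and_ne.1 ha
  obtain ⟨⟨s, ⟨hs₀, hs₁⟩, rfl⟩, -⟩ := sbtw_iff_mem_image_Ioo_and_ne.1 hb
  obtain ⟨⟨t, ⟨ht₀, ht₁⟩, rfl⟩, -⟩ := sbtw_iff_mem_image_Ioo_and_ne.1 hd
  rw [doubleArea_lineMap, abs_mul]
  have hr := sub_pos.2 hr₁
  have hs := sub_pos.2 hs₁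
  have ht := sub_pos.2 ht₁
  have hpos : 0 < (1 - r) * (1 - s) * (1 - t) + r * s * t := by positivity
  have hlt : (1 - r) * (1 - s) * (1 - t) + r * s * t < 1 := by
    nlinarith [mul_pos hr₀ hs, mul_pos hs₀ ht, mul_pos ht₀ hr]
  refine ⟨mul_ne_zero hpos.ne' h, ?_⟩
  rw [abs_of_pos hpos]
  exact mul_lt_of_lt_one_left (abs_pos.2 h) hlt

lemma BlockedColouring.doubleArea_eq_zero {P : Set (ℝ × ℝ)} {c : ℝ × ℝ → Fin 2}
    (hc : BlockedColouring P c) (hP : P.Finite) {x y z : ℝ × ℝ}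
    (hx : x ∈ P) (hy : y ∈ P) (hz : z ∈ P) (hxy : c x = c y) (hxz : c x = c z) :
    doubleArea x y z = 0 := by
  by_contra h
  let S : Set ((ℝ × ℝ) × (ℝ × ℝ) × (ℝ × ℝ)) :=
    {p | p ∈ P ×ˢ P ×ˢ P ∧ c p.1 = c p.2.1 ∧ c p.1 = c p.2.2 ∧ doubleArea p.1 p.2.1 p.2.2 ≠ 0}
  have hS : S.Finite := (hP.prod (hP.prod hP)).subset fun p hp => hp.1
  obtain ⟨⟨x, y, z⟩, ⟨⟨hx, hy, hz⟩, hxy, hxz, h⟩, hmin⟩ :=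
    Set.exists_min_image S (fun p => |doubleArea p.1 p.2.1 p.2.2|) hS
      ⟨(x, y, z), ⟨hx, hy, hz⟩, hxy, hxz, h⟩
  dsimp only at hx hy hz hxy hxz h hmin
  have h₁ : x ≠ y := by rintro rfl; simp [doubleArea] at h
  have h₂ : y ≠ z := by rintro rfl; apply h; simp only [doubleArea]; ring
  have h₃ : z ≠ x := by rintro rfl; simp [doubleArea] at h
  obtain ⟨a, ha, hca, hsa⟩ := hc.exists_sbtw hP hx hy h₁ hxy
  obtain ⟨b, hb, hcb, hsb⟩ := hc.exists_sbtw hP hy hz h₂ (hxy.symm.trans hxz)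
  obtain ⟨d, hd, hcd, hsd⟩ := hc.exists_sbtw hP hz hx h₃ hxz.symm
  obtain ⟨h0, hlt⟩ := abs_doubleArea_lt h hsa hsb hsd
  exact hlt.not_ge (hmin (a, b, d) ⟨⟨ha, hb, hd⟩, by dsimp only; omega, by dsimp only; omega, h0⟩)

lemma BlockedColouring.ncard_le_two {P : Set (ℝ × ℝ)} {c : ℝ × ℝ → Fin 2}
    (hc : BlockedColouring P c) (hP : P.Finite) (i : Fin 2) : (P ∩ c ⁻¹' {i}).ncard ≤ 2 := by
  by_contra! h
  obtain ⟨x, y, z, ⟨hx, rfl⟩, ⟨hy, hcy⟩, ⟨hz, hcz⟩, h₁, h₂, h₃⟩ :=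
    (Set.two_lt_ncard_iff (hP.inter_of_left _)).1 h
  exact hc.not_collinear hP hx hy hz hcy.symm hcz.symm h₁ h₂ h₃ <|
    collinear_of_doubleArea_eq_zero <|
      hc.doubleArea_eq_zero hP hx hy hz hcy.symm hcz.symm

lemma BlockedColouring.not_both_two {P : Set (ℝ × ℝ)} {c : ℝ × ℝ → Fin 2}
    (hc : BlockedColouring P c) (hP : P.Finite) :
    ¬ ∀ i, (P ∩ c ⁻¹' {i}).ncard = 2 := by
  intro h
  obtain ⟨x, y, hxy, hA⟩ := Set.ncard_eq_two.1 (h 0)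
  have hx : x ∈ P ∩ c ⁻¹' {0} := hA ▸ by simp
  have hy : y ∈ P ∩ c ⁻¹' {0} := hA ▸ by simp
  obtain ⟨hx, hcx : c x = 0⟩ := hx
  obtain ⟨hy, hcy : c y = 0⟩ := hy
  obtain ⟨b, hb, hcb, hs⟩ := hc.exists_sbtw hP hx hy hxy (hcx.trans hcy.symm)
  obtain ⟨d, ⟨hd, hcd : c d = 1⟩, hbd⟩ := Set.exists_ne_of_one_lt_ncard
    (show 1 < (P ∩ c ⁻¹' {1}).ncard by rw [h 1]; norm_num) b
  obtain ⟨a, ha, hca, hs'⟩ := hc.exists_sbtw hP hb hd hbd.symm (by omega)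
  have ha' : a ∈ P ∩ c ⁻¹' {0} := ⟨ha, show c a = 0 by omega⟩
  rw [hA] at ha'
  rcases ha' with rfl | rfl
  · exact hc.not_sbtw hy hd hb (by omega) (hs.symm.trans_expand_left hs')
  · exact hc.not_sbtw hx hd hb (by omega) (hs.trans_expand_left hs')

/-- The colouring of the plane that distinguishes the origin from all other points. -/
noncomputable def originColouring (p : ℝ × ℝ) : Fin 2 :=
  if p = 0 then 0 else 1

lemma originColouring_eq_zero {p : ℝ × ℝ} : originColouring p = 0 ↔ p = 0 := by
  simp [originColouring]

lemma originColouring_eq_one {p : ℝ × ℝ} : originColouring p = 1 ↔ p ≠ 0 := by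
  simp [originColouring]

lemma originColouring_preimage_zero : originColouring ⁻¹' {0} = {0} := by
  ext p
  simp [originColouring_eq_zero]

lemma originColouring_preimage_one : originColouring ⁻¹' {1} = {0}ᶜ := by
  ext p
  simp [originColouring_eq_one]

lemma blockedColouring_originColouring {P : Set (ℝ × ℝ)}
    (hvis : ∀ v ∈ P, v ≠ 0 → Visible P 0 v)
    (hblock : ∀ v ∈ P, ∀ w ∈ P, v ≠ 0 → w ≠ 0 → v ≠ w → ¬ Visible P v w) :
    BlockedColouring P originColouring := by
  intro v hv w hw hvw
  by_cases hv0 : v = 0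
  · subst hv0
    simp [originColouring, hvw.symm, hvis w hw hvw.symm]
  · by_cases hw0 : w = 0
    · subst hw0
      have h : Visible P v 0 := fun x hx hb =>
        hvis v hv hvw x hx (by rwa [Blocks, openSegment_symm])
      simp [originColouring, hvw, h]
    · simp [originColouring, hv0, hw0, hblock v hv w hw hv0 hw0 hvw]

lemma representable_one_one : Representable {1, 1} := by
  refine ⟨{0, (1, 0)}, by simp, 2, originColouring, blockedColouring_originColouring ?_ ?_, ?_⟩
  · rintro v (rfl | rfl) hv x (rfl | rfl) ⟨a, b, ha, hb, hab, h⟩ <;>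
      simp_all [Prod.ext_iff]
  · rintro v (rfl | rfl) w (rfl | rfl) <;> simp
  · have h : ({0, (1, 0)} ∩ {0}ᶜ : Set (ℝ × ℝ)) = {(1, 0)} := by
      ext p
      simp only [Set.mem_inter_iff, Set.mem_insert_iff, Set.mem_singleton_iff, Set.mem_compl_iff]
      constructor
      · tauto
      · rintro rfl
        simp
    have h' : ({0, (1, 0)} ∩ {0} : Set (ℝ × ℝ)) = {0} := by simp
    rw [Fin.univ_val_map]
    simp [originColouring_preimage_zero, originColouring_preimage_one, h, h']
    rfl

lemma representable_one_two : Representable {1, 2} := by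
  refine ⟨{0, (1, 0), (-1, 0)}, by simp, 2, originColouring,
    blockedColouring_originColouring ?_ ?_, ?_⟩
  · rintro v (rfl | rfl | rfl) hv x (rfl | rfl | rfl) ⟨a, b, ha, hb, hab, h⟩ <;>
      simp_all [Prod.ext_iff] <;> linarith
  · have h₀ : Blocks (0 : ℝ × ℝ) (1, 0) (-1, 0) :=
      ⟨1 / 2, 1 / 2, by norm_num, by norm_num, by norm_num, by simp⟩
    have h₁ : Blocks (0 : ℝ × ℝ) (-1, 0) (1, 0) := by rwa [Blocks, openSegment_symm]
    rintro v (rfl | rfl | rfl) w (rfl | rfl | rfl) hv hw hvw hvis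
    all_goals first
      | contradiction
      | exact hvis 0 (by simp) h₀
      | exact hvis 0 (by simp) h₁
  · have h : ({0, (1, 0), (-1, 0)} ∩ {0}ᶜ : Set (ℝ × ℝ)) = {(1, 0), (-1, 0)} := by
      ext p
      simp only [Set.mem_inter_iff, Set.mem_insert_iff, Set.mem_singleton_iff, Set.mem_compl_iff]
      constructor
      · tauto
      · rintro (rfl | rfl) <;> simp
    have h' : ({0, (1, 0), (-1, 0)} ∩ {0} : Set (ℝ × ℝ)) = {0} := by simp
    have h₂ : ({(1, 0), (-1, 0)} : Set (ℝ × ℝ)).ncard = 2 :=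
      Set.ncard_pair (by simp; norm_num)
    rw [Fin.univ_val_map]
    simp [originColouring_preimage_zero, originColouring_preimage_one, h, h', h₂]
    rfl

/-- `{1,1}` and `{1,2}` are the only representable 2-sets. -/
theorem representable_two_sets (n₁ n₂ : ℕ) (h₁ : 0 < n₁) (h₂ : 0 < n₂) :
    Representable {n₁, n₂} ↔
      ({n₁, n₂} : Multiset ℕ) = {1, 1} ∨ ({n₁, n₂} : Multiset ℕ) = {1, 2} := by
  constructor
  · rintro ⟨P, hP, k, c, hc, hN⟩
    obtain rfl : k = 2 := by simpa using (congrArg Multiset.card hN).symm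
    have hmem : ∀ n ∈ ({n₁, n₂} : Multiset ℕ), n ≤ 2 := by
      intro n hn
      rw [hN] at hn
      obtain ⟨i, -, rfl⟩ := Multiset.mem_map.1 hn
      exact hc.ncard_le_two hP i
    have hle₁ := hmem n₁ (by simp)
    have hle₂ := hmem n₂ (by simp)
    have hne : ¬ (n₁ = 2 ∧ n₂ = 2) := by
      rintro ⟨rfl, rfl⟩
      refine hc.not_both_two hP fun i => ?_
      have hi : (P ∩ c ⁻¹' {i}).ncard ∈ ({2, 2} : Multiset ℕ) :=
        hN ▸ Multiset.mem_map_of_mem _ (Finset.mem_univ i)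
      simpa using hi
    clear hN hmem
    interval_cases n₁ <;> interval_cases n₂ <;> first | exact absurd ⟨rfl, rfl⟩ hne | decide
  · rintro (h | h) <;> rw [h]
    exacts [representable_one_one, representable_one_two]
end

section
/- If k ≥ 4, the multiset {n₁,…,n_{k−1}} of positive integers is representable, and n_k ∈ {1,2,3}, then the multiset {n₁,…,n_{k−1},n_k} is representable. -/
/-- Twice the signed area of the triangle `u v x`. -/
def signedArea (u v x : ℝ × ℝ) : ℝ :=
  (v.1 - u.1) * (x.2 - u.2) - (v.2 - u.2) * (x.1 - u.1)

theorem signedArea_eq_zero_of_eq_combo {u v x : ℝ × ℝ} {a b : ℝ} (hab : a + b = 1)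
    (h : a • u + b • x = v) : signedArea u v x = 0 := by
  subst h
  obtain rfl : a = 1 - b := by linarith
  simp only [signedArea, Prod.fst_add, Prod.snd_add, Prod.smul_fst, Prod.smul_snd, smul_eq_mul]
  ring

theorem signedArea_eq_zero_of_mem_openSegment {u v x : ℝ × ℝ} (h : x ∈ openSegment ℝ u v) :
    signedArea u v x = 0 := by
  obtain ⟨a, b, -, -, hab, rfl⟩ := h
  obtain rfl : a = 1 - b := by linarith
  simp only [signedArea, Prod.fst_add, Prod.snd_add, Prod.smul_fst, Prod.smul_snd, smul_eq_mul]
  ring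

theorem signedArea_eq_zero_of_mem_openSegment' {u v x : ℝ × ℝ} (h : v ∈ openSegment ℝ u x) :
    signedArea u v x = 0 := by
  obtain ⟨a, b, -, -, hab, h⟩ := h
  exact signedArea_eq_zero_of_eq_combo hab h

theorem exists_eq_smul_add_of_signedArea_eq_zero {u v x : ℝ × ℝ} (huv : u ≠ v)
    (h : signedArea u v x = 0) : ∃ s : ℝ, x = s • (v - u) + u := by
  unfold signedArea at h
  by_cases h1 : v.1 - u.1 = 0
  · have h2 : v.2 - u.2 ≠ 0 := fun h2 =>
      huv (Prod.ext (by linarith) (by linarith))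
    refine ⟨(x.2 - u.2) / (v.2 - u.2), Prod.ext ?_ ?_⟩ <;> simp
    · field_simp; linear_combination -h
    · field_simp; ring
  · refine ⟨(x.1 - u.1) / (v.1 - u.1), Prod.ext ?_ ?_⟩ <;> simp
    · field_simp; ring
    · field_simp; linear_combination h

theorem collinear_of_signedArea_eq_zero {u v p q r : ℝ × ℝ} (huv : u ≠ v)
    (hp : signedArea u v p = 0) (hq : signedArea u v q = 0) (hr : signedArea u v r = 0) :
    Collinear ℝ {p, q, r} := by
  refine (collinear_iff_exists_forall_eq_smul_vadd _).2 ⟨u, v - u, ?_⟩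
  rintro x (rfl | rfl | rfl)
  · simpa using exists_eq_smul_add_of_signedArea_eq_zero huv hp
  · simpa using exists_eq_smul_add_of_signedArea_eq_zero huv hq
  · simpa using exists_eq_smul_add_of_signedArea_eq_zero huv hr

theorem Wbtw.mem_openSegment {E : Type*} [AddCommGroup E] [Module ℝ E] {x y z : E}
    (h : Wbtw ℝ x y z) (hx : y ≠ x) (hz : y ≠ z) : y ∈ openSegment ℝ x z :=
  mem_openSegment_of_ne_left_right hx.symm hz.symm h.mem_segment

/-- The vertex `x` of the triangle `x y z` such that `p`, `q`, `r` divide the sides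
`x y`, `y z`, `z x` in the ratio `t : 1 - t`. -/
noncomputable def circumscribedVertex (t : ℝ) (p q r : ℝ × ℝ) : ℝ × ℝ :=
  (1 - 3 * t + 3 * t ^ 2)⁻¹ • ((1 - t) ^ 2 • p - (t * (1 - t)) • q + t ^ 2 • r)

theorem circumscribedVertex_denom_pos (t : ℝ) : 0 < 1 - 3 * t + 3 * t ^ 2 := by
  nlinarith [sq_nonneg (2 * t - 1)]

theorem mem_openSegment_circumscribedVertex {t : ℝ} (h0 : 0 < t) (h1 : t < 1) (p q r : ℝ × ℝ) :
    p ∈ openSegment ℝ (circumscribedVertex t p q r) (circumscribedVertex t q r p) := by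
  have hD := (circumscribedVertex_denom_pos t).ne'
  refine ⟨1 - t, t, by linarith, h0, by ring, Prod.ext ?_ ?_⟩ <;>
  · simp only [circumscribedVertex, Prod.fst_add, Prod.snd_add, Prod.smul_fst, Prod.smul_snd,
      Prod.fst_sub, Prod.snd_sub, smul_eq_mul]
    rw [mul_left_comm, mul_left_comm t, ← mul_add, inv_mul_eq_iff_eq_mul₀ hD]
    ring

theorem signedArea_circumscribedVertex (t : ℝ) (u v p q r : ℝ × ℝ) :
    (1 - 3 * t + 3 * t ^ 2) * signedArea u v (circumscribedVertex t p q r) =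
      (1 - t) ^ 2 * signedArea u v p - t * (1 - t) * signedArea u v q +
        t ^ 2 * signedArea u v r := by
  have hD := (circumscribedVertex_denom_pos t).ne'
  simp only [signedArea, circumscribedVertex, Prod.fst_add, Prod.snd_add, Prod.smul_fst,
    Prod.smul_snd, Prod.fst_sub, Prod.snd_sub, smul_eq_mul]
  field_simp
  ring

theorem finite_setOf_quadratic_eq_zero {α β γ : ℝ} (h : ¬ (α = 0 ∧ β = 0 ∧ γ = 0)) :
    {t : ℝ | (1 - t) ^ 2 * α - t * (1 - t) * β + t ^ 2 * γ = 0}.Finite := by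
  open Polynomial in
  let f : ℝ[X] := (1 - X) ^ 2 * C α - X * (1 - X) * C β + X ^ 2 * C γ
  have hf (t : ℝ) : f.eval t = (1 - t) ^ 2 * α - t * (1 - t) * β + t ^ 2 * γ := by
    simp only [f, Polynomial.eval_add, Polynomial.eval_sub, Polynomial.eval_mul,
      Polynomial.eval_pow, Polynomial.eval_one, Polynomial.eval_X, Polynomial.eval_C]
  have hne : f ≠ 0 := by
    intro h0
    simp only [h0, Polynomial.eval_zero] at hf
    have e0 := hf 0
    have e1 := hf 1
    have e2 := hf 2
    norm_num at e0 e1 e2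
    exact h ⟨e0.symm, by linarith, e1.symm⟩
  simpa only [Polynomial.IsRoot, hf] using Polynomial.finite_setOfPred_isRoot hne

theorem finite_setOf_signedArea_circumscribedVertex_eq_zero {u v p q r : ℝ × ℝ} (huv : u ≠ v)
    (h : ¬ Collinear ℝ {p, q, r}) :
    {t : ℝ | signedArea u v (circumscribedVertex t p q r) = 0}.Finite := by
  refine (finite_setOf_quadratic_eq_zero (α := signedArea u v p) (β := signedArea u v q)
    (γ := signedArea u v r) fun h' =>
      h (collinear_of_signedArea_eq_zero huv h'.1 h'.2.1 h'.2.2)).subset fun t ht => ?_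
  have := signedArea_circumscribedVertex t u v p q r
  rw [Set.mem_ofPred_eq] at ht ⊢
  rw [← this, ht, mul_zero]

/-- `x` lies on no line through two distinct points of `P`. -/
def OffLines (P : Set (ℝ × ℝ)) (x : ℝ × ℝ) : Prop :=
  ∀ u ∈ P, ∀ v ∈ P, u ≠ v → signedArea u v x ≠ 0

theorem finite_setOf_not_offLines_circumscribedVertex {P : Set (ℝ × ℝ)} (hP : P.Finite)
    {p q r : ℝ × ℝ} (h : ¬ Collinear ℝ {p, q, r}) :
    {t : ℝ | ¬ OffLines P (circumscribedVertex t p q r)}.Finite := by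
  refine (hP.biUnion fun u _ => hP.biUnion fun v _ =>
    (?_ : {t : ℝ | u ≠ v ∧ signedArea u v (circumscribedVertex t p q r) = 0}.Finite)).subset ?_
  · by_cases huv : u = v
    · simp [huv]
    · simpa [huv] using finite_setOf_signedArea_circumscribedVertex_eq_zero huv h
  · intro t ht
    simp only [OffLines, Set.mem_ofPred_eq] at ht
    push Not at ht
    obtain ⟨u, hu, v, hv, huv, h0⟩ := ht
    simp only [Set.mem_iUnion]
    exact ⟨u, hu, v, hv, huv, h0⟩

theorem OffLines.notMem {P : Set (ℝ × ℝ)} {x : ℝ × ℝ} (h : OffLines P x) (hP : P.Nontrivial) :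
    x ∉ P := by
  intro hx
  obtain ⟨y, hy, hyx⟩ := hP.exists_ne x
  exact h x hx y hy hyx.symm (by simp [signedArea])

theorem exists_offLines_triangle {P : Set (ℝ × ℝ)} (hP : P.Finite) {p q r : ℝ × ℝ}
    (h : ¬ Collinear ℝ {p, q, r}) :
    ∃ x y z, OffLines P x ∧ OffLines P y ∧ OffLines P z ∧
      p ∈ openSegment ℝ x y ∧ q ∈ openSegment ℝ y z ∧ r ∈ openSegment ℝ z x := by
  have h₁ : ({q, r, p} : Set (ℝ × ℝ)) = {p, q, r} := by
    ext; simp only [Set.mem_insert_iff, Set.mem_singleton_iff]; tauto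
  have h₂ : ({r, p, q} : Set (ℝ × ℝ)) = {p, q, r} := by
    ext; simp only [Set.mem_insert_iff, Set.mem_singleton_iff]; tauto
  have hbad := ((finite_setOf_not_offLines_circumscribedVertex hP h).union
    (finite_setOf_not_offLines_circumscribedVertex hP (h₁ ▸ h))).union
    (finite_setOf_not_offLines_circumscribedVertex hP (h₂ ▸ h))
  obtain ⟨t, ⟨h0, h1⟩, ht⟩ := ((Set.Ioo_infinite (zero_lt_one' ℝ)).sdiff hbad).nonempty
  simp only [Set.mem_union, Set.mem_ofPred_eq, not_or, not_not] at ht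
  exact ⟨_, _, _, ht.1.1, ht.1.2, ht.2, mem_openSegment_circumscribedVertex h0 h1 p q r,
    mem_openSegment_circumscribedVertex h0 h1 q r p,
    mem_openSegment_circumscribedVertex h0 h1 r p q⟩

/-- A finite set of points in general position with respect to `P`, any two of which are blocked
by a point of `P`, can be added to `P` as a new colour class. -/
theorem IsNBlocked.union {N : Multiset ℕ} {P T : Set (ℝ × ℝ)} (h : IsNBlocked N P)
    (hP : P.Nontrivial) (hT : T.Finite) (hoff : ∀ x ∈ T, OffLines P x)
    (hblock : ∀ x ∈ T, ∀ y ∈ T, x ≠ y → ∃ p ∈ P, p ∈ openSegment ℝ x y) :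
    IsNBlocked (T.ncard ::ₘ N) (P ∪ T) := by
  classical
  obtain ⟨hfin, k, c, hc, rfl⟩ := h
  have hdisj : ∀ x ∈ T, x ∉ P := fun x hx => (hoff x hx).notMem hP
  have hdisj' : ∀ x ∈ P, x ∉ T := fun x hx hxT => hdisj x hxT hx
  have hsee : ∀ x ∈ T, ∀ u ∈ P, Visible (P ∪ T) x u := by
    rintro x hx u hu w (hw | hw) hwx
    · refine hoff x hx u hu w hw ?_
        (signedArea_eq_zero_of_mem_openSegment' (openSegment_symm ℝ x u ▸ hwx))
      rintro rfl
      exact hdisj x hx ((right_mem_openSegment_iff.1 hwx) ▸ hu)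
    · have hxw : x ≠ w := by
        rintro rfl
        exact hdisj x hx ((left_mem_openSegment_iff.1 hwx) ▸ hu)
      obtain ⟨p, hp, hpxw⟩ := hblock x hx w hw hxw
      obtain ⟨a, b, ha, hb, hab, rfl⟩ := hwx
      obtain ⟨d, e, hd, he, hde, rfl⟩ := hpxw
      obtain rfl : a = 1 - b := by linarith
      obtain rfl : d = 1 - e := by linarith
      have heb : 0 < 1 - e * b := by nlinarith
      refine hoff x hx u hu _ hp ?_ (signedArea_eq_zero_of_eq_combo
        (a := e * b) (b := 1 - e * b) (by ring) (by module))
      intro hup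
      have hxu : (1 - e * b) • (u - x) = 0 := by
        rw [← sub_eq_zero.2 hup]
        module
      have : u = x := sub_eq_zero.1 ((smul_eq_zero.1 hxu).resolve_left heb.ne')
      exact hdisj x hx (this ▸ hu)
  refine ⟨hfin.union hT, k + 1, fun x => if x ∈ T then 0 else (c x).succ, ?_, ?_⟩
  · rintro v (hv | hv) w (hw | hw) hvw
    · simp only [hdisj' v hv, hdisj' w hw, if_false, ne_eq, Fin.succ_inj]
      rw [← ne_eq, ← hc v hv w hw hvw]
      refine ⟨fun h x hx => h x (Or.inl hx), fun h x hx hxb => ?_⟩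
      rcases hx with hx | hx
      · exact h x hx hxb
      · exact hoff x hx v hv w hw hvw (signedArea_eq_zero_of_mem_openSegment hxb)
    · simp only [hdisj' v hv, hw, if_false, if_true]
      refine iff_of_true (fun x hx hxb => ?_) (Fin.succ_ne_zero _)
      exact hsee w hw v hv x hx (by rwa [Blocks, openSegment_symm])
    · simp only [hdisj' w hw, hv, if_false, if_true]
      exact iff_of_true (hsee v hv w hw) (Fin.succ_ne_zero _).symm
    · simp only [hv, hw, if_true, ne_eq, not_true, iff_false]
      obtain ⟨p, hp, hpb⟩ := hblock v hv w hw hvw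
      exact fun h => h p (Or.inl hp) hpb
  · have hzero : (P ∪ T) ∩ (fun x => if x ∈ T then 0 else (c x).succ) ⁻¹' {0} = T := by
      ext x
      by_cases hx : x ∈ T <;> simp [hx, Fin.succ_ne_zero]
    have hsucc (i : Fin k) : (P ∪ T) ∩ (fun x => if x ∈ T then 0 else (c x).succ) ⁻¹' {i.succ} =
        P ∩ c ⁻¹' {i} := by
      ext x
      by_cases hx : x ∈ T
      · simp [hx, hdisj x hx, (Fin.succ_ne_zero i).symm]
      · simp [hx]
    simp [Fin.univ_succ, hzero, hsucc, Function.comp_def]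

theorem IsNBlocked.exists_not_collinear {N : Multiset ℕ} {P : Set (ℝ × ℝ)} (h : IsNBlocked N P)
    (hcard : 3 ≤ Multiset.card N) (hpos : ∀ n ∈ N, 0 < n) :
    ∃ p ∈ P, ∃ q ∈ P, ∃ r ∈ P, ¬ Collinear ℝ {p, q, r} := by
  obtain ⟨-, k, c, hc, rfl⟩ := h
  replace hcard : 3 ≤ k := by simpa using hcard
  have hne (i : Fin k) : ∃ x ∈ P, c x = i :=
    Set.nonempty_of_ncard_ne_zero (s := P ∩ c ⁻¹' {i})
      (hpos _ (Multiset.mem_map_of_mem _ (Finset.mem_univ_val i))).ne'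
  obtain ⟨p, hp, hcp⟩ := hne ⟨0, by omega⟩
  obtain ⟨q, hq, hcq⟩ := hne ⟨1, by omega⟩
  obtain ⟨r, hr, hcr⟩ := hne ⟨2, by omega⟩
  have hpq : c p ≠ c q := by simp [hcp, hcq]
  have hqr : c q ≠ c r := by simp [hcq, hcr]
  have hpr : c p ≠ c r := by simp [hcp, hcr]
  have hvis {u v w : ℝ × ℝ} (hu : u ∈ P) (hv : v ∈ P) (hw : w ∈ P) (huv : c u ≠ c v)
      (huw : c u ≠ c w) (hvw : c v ≠ c w) : ¬ Wbtw ℝ u v w := fun hb =>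
    (hc u hu w hw (ne_of_apply_ne c huw)).2 huw v hv
      (hb.mem_openSegment (ne_of_apply_ne c huv.symm) (ne_of_apply_ne c hvw))
  refine ⟨p, hp, q, hq, r, hr, fun hcol => ?_⟩
  rcases hcol.wbtw_or_wbtw_or_wbtw with hb | hb | hb
  · exact hvis hp hq hr hpq hpr hqr hb
  · exact hvis hq hr hp hqr hpq.symm hpr.symm hb
  · exact hvis hr hp hq hpr.symm hqr.symm hpq hb

/-- If `k ≥ 4`, the `(k-1)`-set `N` is representable and `m ∈ {1,2,3}`, then the
`k`-set obtained by adding `m` to `N` is representable. -/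
theorem representable_add_small_class (N : Multiset ℕ) (hcard : 3 ≤ Multiset.card N)
    (hpos : ∀ n ∈ N, 0 < n) (hrep : Representable N)
    (m : ℕ) (hm : m = 1 ∨ m = 2 ∨ m = 3) :
    Representable (m ::ₘ N) := by
  obtain ⟨P, hP⟩ := hrep
  obtain ⟨p, hp, q, hq, r, hr, hcol⟩ := hP.exists_not_collinear hcard hpos
  have hnt : P.Nontrivial := by
    refine ⟨p, hp, q, hq, ?_⟩
    rintro rfl
    exact hcol (by simpa using collinear_pair ℝ p r)
  obtain ⟨x, y, z, hx, hy, hz, hxy, hyz, hzx⟩ := exists_offLines_triangle hP.1 hcol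
  have hne {u v w : ℝ × ℝ} (hu : OffLines P u) (hw : w ∈ P) (h : w ∈ openSegment ℝ u v) :
      u ≠ v := by
    rintro rfl
    rw [openSegment_same, Set.mem_singleton_iff] at h
    exact hu.notMem hnt (h ▸ hw)
  have hxy' := hne hx hp hxy
  have hyz' := hne hy hq hyz
  have hzx' := hne hz hr hzx
  have hblock : ∀ a ∈ ({x, y, z} : Set (ℝ × ℝ)), ∀ b ∈ ({x, y, z} : Set (ℝ × ℝ)), a ≠ b →
      ∃ w ∈ P, w ∈ openSegment ℝ a b := by
    rintro a (rfl | rfl | rfl) b (rfl | rfl | rfl) hab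
    · exact absurd rfl hab
    · exact ⟨p, hp, hxy⟩
    · exact ⟨r, hr, by rwa [openSegment_symm]⟩
    · exact ⟨p, hp, by rwa [openSegment_symm]⟩
    · exact absurd rfl hab
    · exact ⟨q, hq, hyz⟩
    · exact ⟨r, hr, hzx⟩
    · exact ⟨q, hq, by rwa [openSegment_symm]⟩
    · exact absurd rfl hab
  obtain ⟨T, hT, hTm⟩ : ∃ T ⊆ ({x, y, z} : Set (ℝ × ℝ)), T.ncard = m := by
    refine Set.exists_subset_card_eq ?_
    rw [Set.ncard_eq_three.2 ⟨x, y, z, hxy', hzx'.symm, hyz', rfl⟩]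
    omega
  refine ⟨P ∪ T, hTm ▸ hP.union hnt ((Set.toFinite _).subset hT) ?_ fun a ha b hb =>
    hblock a (hT ha) b (hT hb)⟩
  intro a ha
  rcases hT ha with rfl | rfl | rfl
  exacts [hx, hy, hz]
end
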